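/- Let p be a prime and k a nonnegative integer. Let (α_n) be a sequence of positive real numbers such that for every constant Δ > 0, one has α_n ≥ Δ·(log n)/n for all sufficiently large n. Suppose that for every n ≥ 2 and every k',l' ∈ {1,…,n}, q^{(n)}_{k'l'} is an α_n-balanced probability mass function on F_p, and let P_n denote the induced probability on M_n(F_p). Then lim_{n→∞} Σ_{M ∈ M_n(F_p), rank(M) = n−k} P_n(M) = p^{−k²}·(∏_{j=1}^∞ (1 − p^{−j}))/(∏_{j=1}^k (1 − p^{−j}))². -/

import Mathlib

namespace RankUniv

open Finset

/-- Structure-free bundle: `q` is an `α`-balanced probability mass function. -/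
def Bal {p : ℕ} [Fact p.Prime] (α : ℝ) (q : ZMod p → ℝ) : Prop :=
  (∀ a, 0 ≤ q a) ∧ (∑ a, q a = 1) ∧ ∀ a, q a ≤ 1 - α

lemma exists_gap (p : ℕ) [Fact p.Prime] :
    ∃ C : ℝ, 0 < C ∧ ∀ y : ZMod p, y ≠ 0 → (ZMod.stdAddChar y).re ≤ 1 - C := by
  obtain ⟨y0, hy0, hmin⟩ := Finset.exists_min_image
    (univ.filter (fun y : ZMod p => y ≠ 0)) (fun y => 1 - (ZMod.stdAddChar y).re) ⟨1, by simp⟩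
  refine ⟨1 - (ZMod.stdAddChar y0).re, ?_, ?_⟩
  · have hy0' : y0 ≠ 0 := by simpa using hy0
    have hn : ‖ZMod.stdAddChar y0‖ = 1 := AddChar.norm_apply _ _
    have hle : (ZMod.stdAddChar y0).re ≤ 1 := by
      rw [← hn]; exact Complex.re_le_norm _
    rcases hle.lt_or_eq with h | h
    · linarith
    · exfalso
      have h1 : ZMod.stdAddChar y0 = 1 := by
        have h2 : Complex.normSq (ZMod.stdAddChar y0) = 1 := by
          rw [Complex.normSq_eq_norm_sq, hn]; norm_num
        rw [Complex.normSq_apply, h] at h2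
        have h3 : (ZMod.stdAddChar y0).im = 0 := by
          have : (ZMod.stdAddChar y0).im * (ZMod.stdAddChar y0).im = 0 := by linarith
          simpa using this
        exact Complex.ext (by simpa using h) (by simpa using h3)
      apply hy0'
      apply ZMod.injective_stdAddChar
      rw [h1, AddChar.map_zero_eq_one]
  · intro y hy
    have := hmin y (by simpa using hy)
    linarith

lemma char_bound (p : ℕ) [Fact p.Prime] :
    ∃ c : ℝ, 0 < c ∧ ∀ (α : ℝ) (q : ZMod p → ℝ), Bal α q → ∀ t : ZMod p, t ≠ 0 →
      ‖∑ a, (q a : ℂ) * ZMod.stdAddChar (t * a)‖ ≤ Real.exp (-(c * α)) := by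
  obtain ⟨C, hC, hgap⟩ := exists_gap p
  refine ⟨C / 2, by positivity, ?_⟩
  rintro α q ⟨h0, h1, hb⟩ t ht
  set S := ∑ a, (q a : ℂ) * ZMod.stdAddChar (t * a) with hS
  have key : ‖S‖ ^ 2 ≤ 1 - C * α := by
    have e1 : S * (starRingEnd ℂ) S =
        ∑ a, ∑ b, ((q a * q b : ℝ) : ℂ) * ZMod.stdAddChar (t * (a - b)) := by
      rw [hS, map_sum, Finset.sum_mul_sum]
      refine Finset.sum_congr rfl fun a _ => Finset.sum_congr rfl fun b _ => ?_
      rw [map_mul (starRingEnd ℂ), Complex.conj_ofReal, ← AddChar.map_neg_eq_conj,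
        show t * (a - b) = t * a + -(t * b) by ring, AddChar.map_add_eq_mul]
      push_cast; ring
    have e2 : ‖S‖ ^ 2 = ∑ a, ∑ b, (q a * q b) * (ZMod.stdAddChar (t * (a - b))).re := by
      rw [← Complex.normSq_eq_norm_sq]
      have := congrArg Complex.re e1
      rw [Complex.mul_conj, Complex.ofReal_re] at this
      rw [this, Complex.re_sum]
      refine Finset.sum_congr rfl fun a _ => ?_
      rw [Complex.re_sum]
      refine Finset.sum_congr rfl fun b _ => ?_
      rw [Complex.re_ofReal_mul]
    rw [e2]
    calc ∑ a, ∑ b, (q a * q b) * (ZMod.stdAddChar (t * (a - b))).re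
        ≤ ∑ a, ∑ b, (q a * q b) * ((1 - C) + if a = b then C else 0) := by
          refine Finset.sum_le_sum fun a _ => Finset.sum_le_sum fun b _ => ?_
          refine mul_le_mul_of_nonneg_left ?_ (mul_nonneg (h0 a) (h0 b))
          by_cases hab : a = b
          · subst hab; simp
          · rw [if_neg hab, add_zero]
            exact hgap _ (mul_ne_zero ht (sub_ne_zero.mpr hab))
      _ = (1 - C) + C * ∑ a, q a * q a := by
          have : ∀ a, ∑ b, (q a * q b) * ((1 - C) + if a = b then C else 0)
              = (1 - C) * q a + C * (q a * q a) := by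
            intro a
            simp only [mul_add, Finset.sum_add_distrib, mul_ite, mul_zero, Finset.sum_ite_eq,
              Finset.mem_univ, if_true]
            rw [← Finset.sum_mul, ← Finset.mul_sum, h1]; ring
          simp only [this, Finset.sum_add_distrib, ← Finset.mul_sum, h1, mul_one]
      _ ≤ (1 - C) + C * (1 - α) := by
          have : ∑ a, q a * q a ≤ ∑ a, q a * (1 - α) :=
            Finset.sum_le_sum fun a _ => mul_le_mul_of_nonneg_left (hb a) (h0 a)
          rw [← Finset.sum_mul, h1, one_mul] at this
          have := mul_le_mul_of_nonneg_left this hC.le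
          linarith
      _ = 1 - C * α := by ring
  have h2 : ‖S‖ ^ 2 ≤ (Real.exp (-(C / 2 * α))) ^ 2 := by
    rw [← Real.exp_nat_mul]
    refine key.trans ?_
    have := Real.add_one_le_exp (-(C * α))
    have e : ((2 : ℕ) : ℝ) * -(C / 2 * α) = -(C * α) := by push_cast; ring
    rw [e]; linarith
  exact le_of_sq_le_sq h2 (Real.exp_pos _).le

lemma addChar_sum {ι A : Type*} [AddCommMonoid A] (χ : AddChar A ℂ) (s : Finset ι) (f : ι → A) :
    χ (∑ i ∈ s, f i) = ∏ i ∈ s, χ (f i) := by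
  classical
  induction s using Finset.induction_on with
  | empty => simp
  | insert a s ha ih => rw [Finset.sum_insert ha, Finset.prod_insert ha, AddChar.map_add_eq_mul, ih]

/-- product measure weight of a vector -/
noncomputable def mu {p : ℕ} {ι : Type} [Fintype ι] (q : ι → ZMod p → ℝ) (x : ι → ZMod p) : ℝ :=
  ∏ i, q i (x i)

lemma sum_prod_fun {ι κ R : Type*} [Fintype ι] [DecidableEq ι] [Fintype κ] [CommSemiring R]
    (g : ι → κ → R) : ∑ f : ι → κ, ∏ i, g i (f i) = ∏ i, ∑ j, g i j := by
  rw [← sum_prod_piFinset, Fintype.piFinset_univ]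

lemma mu_nonneg {p : ℕ} [Fact p.Prime] {ι : Type} [Fintype ι] {α : ℝ} {q : ι → ZMod p → ℝ}
    (hq : ∀ i, Bal α (q i)) (x : ι → ZMod p) : 0 ≤ mu q x :=
  Finset.prod_nonneg fun i _ => (hq i).1 _

lemma mu_sum {p : ℕ} [Fact p.Prime] {ι : Type} [Fintype ι] [DecidableEq ι] {α : ℝ}
    {q : ι → ZMod p → ℝ} (hq : ∀ i, Bal α (q i)) : ∑ x, mu q x = 1 := by
  unfold mu
  rw [sum_prod_fun]
  exact Finset.prod_eq_one fun i _ => (hq i).2.1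

open Classical in
lemma fourier {p : ℕ} [Fact p.Prime] {c : ℝ} (hc0 : 0 < c)
    (hc : ∀ (α : ℝ) (q : ZMod p → ℝ), Bal α q → ∀ t : ZMod p, t ≠ 0 →
      ‖∑ a, (q a : ℂ) * ZMod.stdAddChar (t * a)‖ ≤ Real.exp (-(c * α)))
    {ι : Type} [Fintype ι] [DecidableEq ι] {α : ℝ} (hα : 0 < α) {q : ι → ZMod p → ℝ}
    (hq : ∀ i, Bal α (q i)) (D : Submodule (ZMod p) (ι → ZMod p)) (w : ℝ)
    (hw : ∀ v ∈ D, v ≠ 0 → w ≤ (hammingNorm v : ℝ)) :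
    |(∑ x, if (∀ v ∈ D, v ⬝ᵥ x = 0) then mu q x else 0) - ((p : ℝ) ^ Module.finrank (ZMod p) D)⁻¹|
      ≤ (1 - ((p : ℝ) ^ Module.finrank (ZMod p) D)⁻¹) * Real.exp (-(c * α * w)) := by
  set P := ∑ x, if (∀ v ∈ D, v ⬝ᵥ x = 0) then mu q x else 0 with hP
  have hcard : Fintype.card D = p ^ Module.finrank (ZMod p) D := by
    rw [Module.card_eq_pow_finrank (K := ZMod p), ZMod.card]
  set d : ℝ := (p : ℝ) ^ Module.finrank (ZMod p) D with hd
  have hp1 : (1 : ℝ) ≤ p := by exact_mod_cast (Fact.out : p.Prime).one_lt.le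
  have hd1 : 1 ≤ d := one_le_pow₀ hp1
  have hcardR : (Fintype.card D : ℝ) = d := by rw [hcard, hd]; push_cast; rfl
  -- orthogonality
  have horth : ∀ x : ι → ZMod p, ∑ v : D, (ZMod.stdAddChar ((v : ι → ZMod p) ⬝ᵥ x) : ℂ) =
      if (∀ v ∈ D, v ⬝ᵥ x = 0) then (d : ℂ) else 0 := by
    intro x
    let L : D →+ ZMod p :=
      { toFun := fun v => (v : ι → ZMod p) ⬝ᵥ x
        map_zero' := by simp
        map_add' := by intro a b; simp [add_dotProduct] }
    have h := AddChar.sum_eq_ite ((ZMod.stdAddChar (N := p)).compAddMonoidHom L)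
    have hiff : ((ZMod.stdAddChar (N := p)).compAddMonoidHom L = 0) ↔ (∀ v ∈ D, v ⬝ᵥ x = 0) := by
      constructor
      · intro h0 v hv
        have := DFunLike.congr_fun h0 (⟨v, hv⟩ : D)
        apply ZMod.injective_stdAddChar
        rw [AddChar.map_zero_eq_one]
        simpa [L] using this
      · intro h0
        ext v
        have : L v = 0 := h0 v v.2
        simp [this]
    simp only [hiff] at h
    rw [show (d : ℂ) = (Fintype.card D : ℂ) by rw [← hcardR]; push_cast; rfl]
    exact h
  have hmain : ((P * d : ℝ) : ℂ) =
      ∑ v : D, ∏ i, ∑ a, (q i a : ℂ) * ZMod.stdAddChar ((v : ι → ZMod p) i * a) := by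
    have e1 : ((P * d : ℝ) : ℂ) = ∑ x, (mu q x : ℂ) *
        ∑ v : D, (ZMod.stdAddChar ((v : ι → ZMod p) ⬝ᵥ x) : ℂ) := by
      rw [hP, Finset.sum_mul]
      push_cast
      refine Finset.sum_congr rfl fun x _ => ?_
      rw [horth]
      split_ifs <;> simp
    rw [e1]
    simp_rw [Finset.mul_sum]
    rw [Finset.sum_comm]
    refine Finset.sum_congr rfl fun v _ => ?_
    rw [← sum_prod_fun]
    refine Finset.sum_congr rfl fun x _ => ?_
    rw [Finset.prod_mul_distrib]
    congr 1
    · simp [mu]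
    · simp only [dotProduct]
      exact addChar_sum _ _ _
  have hzero : ∏ i, ∑ a, (q i a : ℂ) * ZMod.stdAddChar (((0 : D) : ι → ZMod p) i * a) = 1 := by
    refine Finset.prod_eq_one fun i _ => ?_
    simp only [ZeroMemClass.coe_zero, Pi.zero_apply, zero_mul, AddChar.map_zero_eq_one, mul_one]
    exact_mod_cast (hq i).2.1
  have hterm : ∀ v : D, v ≠ 0 →
      ‖∏ i, ∑ a, (q i a : ℂ) * ZMod.stdAddChar ((v : ι → ZMod p) i * a)‖
        ≤ Real.exp (-(c * α * w)) := by
    intro v hv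
    have hv' : (v : ι → ZMod p) ≠ 0 := by simpa using hv
    rw [norm_prod]
    calc ∏ i, ‖∑ a, (q i a : ℂ) * ZMod.stdAddChar ((v : ι → ZMod p) i * a)‖
        ≤ ∏ i, (if (v : ι → ZMod p) i ≠ 0 then Real.exp (-(c * α)) else 1) := by
          refine Finset.prod_le_prod (fun _ _ => norm_nonneg _) fun i _ => ?_
          split_ifs with h
          · exact hc α (q i) (hq i) _ h
          · push Not at h
            refine (norm_sum_le _ _).trans ?_
            rw [← (hq i).2.1]
            refine Finset.sum_le_sum fun a _ => ?_
            rw [norm_mul, AddChar.norm_apply, mul_one, Complex.norm_real, Real.norm_eq_abs,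
              abs_of_nonneg ((hq i).1 a)]
      _ = Real.exp (-(c * α)) ^ hammingNorm (v : ι → ZMod p) := by
          rw [Finset.prod_ite]
          simp [hammingNorm]
      _ = Real.exp (-(c * α * hammingNorm (v : ι → ZMod p))) := by
          rw [← Real.exp_nat_mul]; congr 1; ring
      _ ≤ _ := by
          apply Real.exp_le_exp.mpr
          have := mul_le_mul_of_nonneg_left (hw v v.2 hv') (mul_pos hc0 hα).le
          linarith
  have hfin : |P * d - 1| ≤ (d - 1) * Real.exp (-(c * α * w)) := by
    have e : ((P * d - 1 : ℝ) : ℂ) = ∑ v ∈ univ.erase (0 : D),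
        ∏ i, ∑ a, (q i a : ℂ) * ZMod.stdAddChar ((v : ι → ZMod p) i * a) := by
      rw [Complex.ofReal_sub, hmain, ← Finset.add_sum_erase _ _ (Finset.mem_univ (0 : D)), hzero]
      simp
    have : |P * d - 1| = ‖((P * d - 1 : ℝ) : ℂ)‖ := by
      rw [Complex.norm_real, Real.norm_eq_abs]
    rw [this, e]
    refine (norm_sum_le_of_le _ (fun v hv => hterm v (Finset.ne_of_mem_erase hv))).trans ?_
    rw [Finset.sum_const, Finset.card_erase_of_mem (Finset.mem_univ _), Finset.card_univ,
      nsmul_eq_mul, Nat.cast_sub Fintype.card_pos, hcardR]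
    simp
  have hdpos : 0 < d := by linarith
  have e3 : P - d⁻¹ = (P * d - 1) * d⁻¹ := by field_simp
  rw [e3, abs_mul, abs_of_pos (inv_pos.mpr hdpos)]
  calc |P * d - 1| * d⁻¹ ≤ ((d - 1) * Real.exp (-(c * α * w))) * d⁻¹ :=
        mul_le_mul_of_nonneg_right hfin (inv_pos.mpr hdpos).le
    _ = _ := by field_simp

open Classical in
lemma prob_orth {p : ℕ} [Fact p.Prime] {c : ℝ} (hc0 : 0 < c)
    (hc : ∀ (α : ℝ) (q : ZMod p → ℝ), Bal α q → ∀ t : ZMod p, t ≠ 0 →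
      ‖∑ a, (q a : ℂ) * ZMod.stdAddChar (t * a)‖ ≤ Real.exp (-(c * α)))
    {ι : Type} [Fintype ι] [DecidableEq ι] {α : ℝ} (hα : 0 < α) {q : ι → ZMod p → ℝ}
    (hq : ∀ i, Bal α (q i)) (v : ι → ZMod p) (hv : v ≠ 0) :
    (∑ x, if v ⬝ᵥ x = 0 then mu q x else 0)
      ≤ (p : ℝ)⁻¹ + (1 - (p : ℝ)⁻¹) * Real.exp (-(c * α * hammingNorm v)) := by
  have h := fourier hc0 hc hα hq (Submodule.span (ZMod p) {v}) (hammingNorm v) (by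
    intro u hu hu0
    obtain ⟨a, rfl⟩ := Submodule.mem_span_singleton.mp hu
    have ha : a ≠ 0 := by rintro rfl; simp at hu0
    rw [hammingNorm_smul]
    intro i
    exact IsSMulRegular.of_ne_zero ha)
  rw [finrank_span_singleton hv, pow_one] at h
  have e : ∀ x : ι → ZMod p, (∀ u ∈ Submodule.span (ZMod p) {v}, u ⬝ᵥ x = 0) ↔ v ⬝ᵥ x = 0 := by
    intro x
    constructor
    · intro h; exact h v (Submodule.mem_span_singleton_self v)
    · intro h u hu
      obtain ⟨a, rfl⟩ := Submodule.mem_span_singleton.mp hu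
      rw [smul_dotProduct, h, smul_zero]
  simp only [e] at h
  have := (abs_le.mp h).2
  linarith

end RankUniv

namespace RankUniv

open Finset

lemma sum_pow_wt (p : ℕ) [Fact p.Prime] (a : ℕ) (z : ℝ) :
    ∑ v : Fin a → ZMod p, z ^ hammingNorm v = (1 + (p - 1) * z) ^ a := by
  classical
  have h1 : ∀ v : Fin a → ZMod p, z ^ hammingNorm v = ∏ i, (if v i ≠ 0 then z else 1) := by
    intro v
    rw [Finset.prod_ite]; simp [hammingNorm]
  simp_rw [h1]
  rw [sum_prod_fun (fun (_ : Fin a) (x : ZMod p) => if x ≠ 0 then z else 1)]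
  have h2 : ∑ x : ZMod p, (if x ≠ 0 then z else 1) = 1 + (p - 1) * z := by
    rw [← Finset.add_sum_erase _ _ (Finset.mem_univ (0 : ZMod p))]
    rw [Finset.sum_congr rfl (g := fun _ => z)
      (fun x hx => by rw [if_pos (Finset.ne_of_mem_erase hx)])]
    rw [Finset.sum_const, Finset.card_erase_of_mem (Finset.mem_univ _), Finset.card_univ,
      ZMod.card, nsmul_eq_mul, Nat.cast_sub (Fact.out : p.Prime).one_lt.le]
    simp
  rw [Finset.prod_congr rfl (fun _ _ => h2)]
  simp

lemma theta_bound {K x : ℝ} (hK : 2 ≤ K) (hx : 0 ≤ x) {n b : ℕ} (hb : n ≤ 2 * b) :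
    (K⁻¹ + (1 - K⁻¹) * Real.exp (-x)) ^ b ≤ Real.exp (-(n * x / 8)) + Real.exp (-((n : ℝ) / 8)) := by
  have hKi : K⁻¹ ≤ 2⁻¹ := inv_anti₀ (by norm_num) hK
  have hKp : 0 < K⁻¹ := inv_pos.mpr (by linarith)
  have hex : Real.exp (-x) ≤ 1 := Real.exp_le_one_iff.mpr (by linarith)
  have hex0 := Real.exp_pos (-x)
  set y := 1 - Real.exp (-x) with hy
  have hy0 : 0 ≤ y := by linarith
  have hbn : (n : ℝ) ≤ 2 * b := by exact_mod_cast hb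
  have h1 : K⁻¹ + (1 - K⁻¹) * Real.exp (-x) ≤ Real.exp (-(y / 2)) := by
    have := Real.add_one_le_exp (-(y / 2))
    have e : Real.exp (-x) = 1 - y := by rw [hy]; ring
    rw [e]
    nlinarith
  have h0 : 0 ≤ K⁻¹ + (1 - K⁻¹) * Real.exp (-x) := by
    have : 0 ≤ (1 - K⁻¹) * Real.exp (-x) := mul_nonneg (by linarith) hex0.le
    linarith
  have h2 : (K⁻¹ + (1 - K⁻¹) * Real.exp (-x)) ^ b ≤ Real.exp (-(n * y / 4)) := by
    refine (pow_le_pow_left₀ h0 h1 b).trans ?_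
    rw [← Real.exp_nat_mul]
    apply Real.exp_le_exp.mpr
    nlinarith
  refine h2.trans ?_
  have hn : (0 : ℝ) ≤ n := Nat.cast_nonneg n
  rcases le_total x 1 with hx1 | hx1
  · have h3 : x / 2 ≤ y := by
      have h4 := Real.add_one_le_exp x
      have h5 : Real.exp (-x) * Real.exp x = 1 := by rw [← Real.exp_add]; simp
      have h6 : Real.exp (-x) * (x + 1) ≤ 1 := by
        have := mul_le_mul_of_nonneg_left h4 hex0.le
        linarith
      have h7 : Real.exp (-x) * (x + 1) ≤ (1 - x / 2) * (x + 1) := by nlinarith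
      have h8 := le_of_mul_le_mul_right h7 (by linarith)
      linarith
    have : Real.exp (-(n * y / 4)) ≤ Real.exp (-(n * x / 8)) := by
      apply Real.exp_le_exp.mpr
      nlinarith
    have := Real.exp_pos (-((n : ℝ) / 8))
    linarith
  · have h3 : 1 / 2 ≤ y := by
      have h4 := Real.add_one_le_exp x
      have h5 : Real.exp (-x) * Real.exp x = 1 := by rw [← Real.exp_add]; simp
      have h6 : Real.exp (-x) * 2 ≤ 1 := by
        have := mul_le_mul_of_nonneg_left (show (2 : ℝ) ≤ Real.exp x by linarith) hex0.le
        linarith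
      linarith
    have : Real.exp (-(n * y / 4)) ≤ Real.exp (-((n : ℝ) / 8)) := by
      apply Real.exp_le_exp.mpr
      nlinarith
    have := Real.exp_pos (-(n * x / 8))
    linarith

lemma count_light (p : ℕ) [Fact p.Prime] : ∃ δ : ℝ, 0 < δ ∧ ∀ a n : ℕ, a ≤ n →
    ∑ v : Fin a → ZMod p, (if (hammingNorm v : ℝ) < δ * n then (1 : ℝ) else 0)
      ≤ Real.exp ((n : ℝ) / 16) := by
  have hp2 : (2 : ℝ) ≤ p := by exact_mod_cast (Fact.out : p.Prime).two_le
  set l := Real.log (32 * p) with hl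
  have hlpos : 0 < l := Real.log_pos (by linarith)
  refine ⟨1 / (32 * l), by positivity, ?_⟩
  intro a n han
  have han' : (a : ℝ) ≤ n := by exact_mod_cast han
  set y := Real.exp (-l) with hy
  have hyv : y = (32 * (p : ℝ))⁻¹ := by rw [hy, Real.exp_neg, hl, Real.exp_log (by linarith)]
  calc ∑ v : Fin a → ZMod p, (if (hammingNorm v : ℝ) < 1 / (32 * l) * n then (1 : ℝ) else 0)
      ≤ ∑ v : Fin a → ZMod p, Real.exp ((n : ℝ) / 32) * y ^ hammingNorm v := by
        refine Finset.sum_le_sum fun v _ => ?_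
        split_ifs with h
        · rw [hy, ← Real.exp_nat_mul, ← Real.exp_add]
          apply Real.one_le_exp
          have : l * (hammingNorm v : ℝ) ≤ l * (1 / (32 * l) * n) :=
            mul_le_mul_of_nonneg_left h.le hlpos.le
          have e : l * (1 / (32 * l) * n) = (n : ℝ) / 32 := by field_simp
          linarith
        · positivity
    _ = Real.exp ((n : ℝ) / 32) * (1 + (p - 1) * y) ^ a := by
        rw [← Finset.mul_sum, sum_pow_wt]
    _ ≤ Real.exp ((n : ℝ) / 32) * Real.exp ((n : ℝ) / 32) := by
        refine mul_le_mul_of_nonneg_left ?_ (Real.exp_pos _).le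
        have h1 : 1 + ((p : ℝ) - 1) * y ≤ Real.exp (1 / 32) := by
          have := Real.add_one_le_exp (1 / 32 : ℝ)
          have : ((p : ℝ) - 1) * y ≤ 1 / 32 := by
            have h2 : (p : ℝ) * y = 1 / 32 := by rw [hyv]; field_simp
            have : 0 < y := Real.exp_pos _
            nlinarith
          linarith
        have h0 : 0 ≤ 1 + ((p : ℝ) - 1) * y := by
          have : 0 < y := Real.exp_pos _
          nlinarith
        refine (pow_le_pow_left₀ h0 h1 a).trans ?_
        rw [← Real.exp_nat_mul]
        apply Real.exp_le_exp.mpr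
        linarith
    _ = _ := by rw [← Real.exp_add]; congr 1; ring

lemma light_sum (p : ℕ) [Fact p.Prime] {δ : ℝ} (hδ : ∀ a n : ℕ, a ≤ n →
    ∑ v : Fin a → ZMod p, (if (hammingNorm v : ℝ) < δ * n then (1 : ℝ) else 0)
      ≤ Real.exp ((n : ℝ) / 16)) {a b n : ℕ} (ha : a ≤ n) (hb : n ≤ 2 * b) {β z : ℝ} (hβ : 0 ≤ β)
    (hz : Real.exp (-(n * β / 8)) ≤ z) :
    ∑ v : Fin a → ZMod p, (if v ≠ 0 ∧ (hammingNorm v : ℝ) < δ * n then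
      ((p : ℝ)⁻¹ + (1 - (p : ℝ)⁻¹) * Real.exp (-(β * hammingNorm v))) ^ b else 0)
      ≤ ((1 + (p - 1) * z) ^ n - 1) + Real.exp (-((n : ℝ) / 16)) := by
  have hp2 : (2 : ℝ) ≤ p := by exact_mod_cast (Fact.out : p.Prime).two_le
  have hz0 : 0 < z := (Real.exp_pos _).trans_le hz
  calc _ ≤ ∑ v : Fin a → ZMod p, ((if v ≠ 0 then z ^ hammingNorm v else 0) +
          Real.exp (-((n : ℝ) / 8)) * (if (hammingNorm v : ℝ) < δ * n then (1 : ℝ) else 0)) := by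
        refine Finset.sum_le_sum fun v _ => ?_
        by_cases h1 : v ≠ 0 <;> by_cases h2 : (hammingNorm v : ℝ) < δ * n
        · rw [if_pos ⟨h1, h2⟩, if_pos h1, if_pos h2, mul_one]
          refine (theta_bound hp2 (by positivity) hb).trans ?_
          gcongr
          refine le_trans (le_of_eq ?_) (pow_le_pow_left₀ (Real.exp_pos _).le hz _)
          rw [← Real.exp_nat_mul]; congr 1; ring
        · rw [if_neg (by tauto), if_pos h1, if_neg h2]; positivity
        · rw [if_neg (by tauto), if_neg h1, if_pos h2]; positivity
        · rw [if_neg (by tauto), if_neg h1, if_neg h2]; simp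
    _ = ((1 + (p - 1) * z) ^ a - 1) + Real.exp (-((n : ℝ) / 8)) *
        ∑ v : Fin a → ZMod p, (if (hammingNorm v : ℝ) < δ * n then (1 : ℝ) else 0) := by
        rw [Finset.sum_add_distrib, ← Finset.mul_sum]
        congr 1
        rw [← sum_pow_wt, ← Finset.add_sum_erase _ _ (Finset.mem_univ (0 : Fin a → ZMod p)),
          ← Finset.add_sum_erase univ (fun v : Fin a → ZMod p => z ^ hammingNorm v)
            (Finset.mem_univ (0 : Fin a → ZMod p))]
        rw [Finset.sum_congr rfl (g := fun v : Fin a → ZMod p => z ^ hammingNorm v)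
          (fun x hx => by rw [if_pos (Finset.ne_of_mem_erase hx)])]
        simp
    _ ≤ _ := by
        have h1 : (1 + ((p : ℝ) - 1) * z) ^ a ≤ (1 + (p - 1) * z) ^ n := by
          apply pow_le_pow_right₀ _ ha
          nlinarith
        have h2 := mul_le_mul_of_nonneg_left (hδ a n ha) (Real.exp_pos (-((n : ℝ) / 8))).le
        rw [← Real.exp_add] at h2
        have e : -((n : ℝ) / 8) + n / 16 = -((n : ℝ) / 16) := by ring
        rw [e] at h2
        linarith

lemma heavy_sum (p : ℕ) [Fact p.Prime] {δ : ℝ} {s n : ℕ} (hs : s ≤ n) {β z : ℝ} (hβ : 0 ≤ β)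
    (hz : Real.exp (-(β * (δ * n))) ≤ z) :
    ∑ v : Fin (n - s) → ZMod p, (if ¬ (hammingNorm v : ℝ) < δ * n then
      ((p : ℝ)⁻¹ + (1 - (p : ℝ)⁻¹) * Real.exp (-(β * hammingNorm v))) ^ n else 0)
      ≤ ((p : ℝ) ^ s)⁻¹ * (1 + (p - 1) * z) ^ n := by
  have hp2 : (2 : ℝ) ≤ p := by exact_mod_cast (Fact.out : p.Prime).two_le
  have hpi : (p : ℝ)⁻¹ ≤ 1 := inv_le_one_of_one_le₀ (by linarith)
  have hz0 : 0 < z := (Real.exp_pos _).trans_le hz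
  calc _ ≤ ∑ v : Fin (n - s) → ZMod p, ((p : ℝ)⁻¹ * (1 + (p - 1) * z)) ^ n := by
        refine Finset.sum_le_sum fun v _ => ?_
        have hb : (0 : ℝ) ≤ 1 + (p - 1) * z := by nlinarith
        split_ifs with h
        · positivity
        · push Not at h
          have h0 : 0 ≤ (1 - (p : ℝ)⁻¹) * Real.exp (-(β * hammingNorm v)) :=
            mul_nonneg (by linarith) (Real.exp_pos _).le
          apply pow_le_pow_left₀ (by positivity)
          have e : (p : ℝ)⁻¹ * (1 + (p - 1) * z) = (p : ℝ)⁻¹ + (1 - (p : ℝ)⁻¹) * z := by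
            field_simp
          rw [e]
          have : Real.exp (-(β * hammingNorm v)) ≤ z := by
            refine le_trans (Real.exp_le_exp.mpr ?_) hz
            have := mul_le_mul_of_nonneg_left h hβ
            linarith
          have := mul_le_mul_of_nonneg_left this (show 0 ≤ 1 - (p : ℝ)⁻¹ by linarith)
          linarith
    _ = _ := by
        rw [Finset.sum_const, Finset.card_univ, nsmul_eq_mul]
        simp only [Fintype.card_fun, ZMod.card, Fintype.card_fin]
        rw [mul_pow, ← mul_assoc]
        congr 1
        push_cast
        obtain ⟨m, rfl⟩ := Nat.exists_eq_add_of_le hs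
        have hp0 : (p : ℝ) ≠ 0 := by linarith
        rw [Nat.add_sub_cancel_left, pow_add, inv_pow, inv_pow]
        field_simp

/-- The backward iterates of the limiting chain. -/
noncomputable def hh (k : ℕ) (Q : ℝ) : ℕ → ℕ → ℝ
  | 0, d => if d = k then 1 else 0
  | t + 1, d => Q ^ d * hh k Q t d + (1 - Q ^ d) * hh k Q t (d - 1)

lemma hh_mem (k : ℕ) {Q : ℝ} (h0 : 0 < Q) (h1 : Q < 1) (t d : ℕ) :
    0 ≤ hh k Q t d ∧ hh k Q t d ≤ 1 := by
  induction t generalizing d with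
  | zero => simp only [hh]; split_ifs <;> norm_num
  | succ t ih =>
    have hq0 : 0 < Q ^ d := pow_pos h0 d
    have hq1 : Q ^ d ≤ 1 := pow_le_one₀ h0.le h1.le
    obtain ⟨a1, a2⟩ := ih d
    obtain ⟨b1, b2⟩ := ih (d - 1)
    simp only [hh]
    constructor <;> nlinarith

lemma hh_small (k : ℕ) (Q : ℝ) (t d : ℕ) (hd : d < k) : hh k Q t d = 0 := by
  induction t generalizing d with
  | zero => simp only [hh]; rw [if_neg (by omega)]
  | succ t ih => simp only [hh]; rw [ih d hd, ih (d - 1) (by omega)]; simp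

lemma hh_big (k : ℕ) (Q : ℝ) (t r : ℕ) (h : t < r) : hh k Q t (k + r) = 0 := by
  induction t generalizing r with
  | zero => simp only [hh]; rw [if_neg (by omega)]
  | succ t ih =>
    simp only [hh]
    obtain ⟨r', rfl⟩ : ∃ r', r = r' + 1 := ⟨r - 1, by omega⟩
    rw [ih _ (by omega), show k + (r' + 1) - 1 = k + r' by omega, ih _ (by omega)]; simp

/-- finite q-Pochhammer -/
noncomputable def qp (Q : ℝ) (s : ℕ) : ℝ := ∏ j ∈ Finset.range s, (1 - Q ^ (j + 1))

lemma qp_succ (Q : ℝ) (s : ℕ) : qp Q (s + 1) = qp Q s * (1 - Q ^ (s + 1)) :=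
  Finset.prod_range_succ _ _

lemma qp_pos {Q : ℝ} (h0 : 0 < Q) (h1 : Q < 1) (s : ℕ) : 0 < qp Q s :=
  Finset.prod_pos fun j _ => by
    have : Q ^ (j + 1) < 1 := pow_lt_one₀ h0.le h1 (by omega)
    linarith

lemma hh_closed (k : ℕ) {Q : ℝ} (h0 : 0 < Q) (h1 : Q < 1) (r u : ℕ) :
    hh k Q (r + u) (k + r) =
      Q ^ (k * u) * qp Q (k + r) * qp Q (r + u) / (qp Q k * qp Q u * qp Q r) := by
  induction hN : r + u generalizing r u with
  | zero =>
    obtain ⟨rfl, rfl⟩ : r = 0 ∧ u = 0 := by omega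
    have := (qp_pos h0 h1 k).ne'
    simp [hh, qp] at this ⊢
    field_simp
  | succ t ih =>
    have hk := (qp_pos h0 h1 k).ne'
    have hh1 : hh k Q (t + 1) (k + r) =
      Q ^ (k + r) * hh k Q t (k + r) + (1 - Q ^ (k + r)) * hh k Q t (k + r - 1) := rfl
    rw [hh1]
    rcases r with _ | r
    · obtain ⟨u, rfl⟩ : ∃ u', u = u' + 1 := ⟨u - 1, by omega⟩
      have hu := (qp_pos h0 h1 u).ne'
      have hu1 := (qp_pos h0 h1 (u + 1)).ne'
      have e1 := ih 0 u (by omega)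
      rw [e1]
      have e2 : (1 - Q ^ (k + 0)) * hh k Q t (k + 0 - 1) = 0 := by
        rcases k with _ | k
        · simp
        · rw [hh_small _ _ _ _ (by omega)]; simp
      rw [e2]
      obtain rfl : t = u := by omega
      simp only [Nat.add_zero]
      have q0 : qp Q 0 = 1 := by simp [qp]
      rw [q0]
      field_simp
      ring
    · have hr := (qp_pos h0 h1 r).ne'
      have hr1 : (1 - Q ^ (r + 1)) ≠ 0 := by
        have := (qp_pos h0 h1 (r + 1)).ne'
        rw [qp_succ] at this
        exact right_ne_zero_of_mul this
      have e2 := ih r u (by omega)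
      rw [show k + (r + 1) - 1 = k + r by omega, e2]
      have hu := (qp_pos h0 h1 u).ne'
      obtain rfl : t = r + u := by omega
      rcases u with _ | u
      · rw [hh_big _ _ _ _ (by omega)]
        rw [← add_assoc k r 1, qp_succ Q (k + r), qp_succ Q r]
        simp only [Nat.add_zero, mul_zero, pow_zero, zero_add, one_mul] at *
        field_simp
      · have hu0 := (qp_pos h0 h1 u).ne'
        have hu1 : (1 - Q ^ (u + 1)) ≠ 0 := by
          rw [qp_succ] at hu
          exact right_ne_zero_of_mul hu
        have e1 := ih (r + 1) u (by omega)
        rw [e1, ← add_assoc k r 1, qp_succ Q (k + r), qp_succ Q r, qp_succ Q (r + (u + 1)),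
          qp_succ Q u]
        field_simp
        ring

lemma hh_limit (p : ℕ) [Fact p.Prime] (k : ℕ) :
    Filter.Tendsto (fun s : ℕ => hh k ((p : ℝ)⁻¹) s s) Filter.atTop
      (nhds (((p : ℝ) ^ (k ^ 2))⁻¹ *
        (∏' j : ℕ, (1 - (p : ℝ)⁻¹ ^ (j + 1))) /
        (∏ j ∈ Finset.range k, (1 - (p : ℝ)⁻¹ ^ (j + 1))) ^ 2)) := by
  have hp2 : (2 : ℝ) ≤ p := by exact_mod_cast (Fact.out : p.Prime).two_le
  set Q := (p : ℝ)⁻¹ with hQ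
  have h0 : 0 < Q := inv_pos.mpr (by linarith)
  have h1 : Q < 1 := inv_lt_one_of_one_lt₀ (by linarith)
  have hsum : Summable (fun j : ℕ => -(Q ^ (j + 1))) := by
    have := (summable_geometric_of_lt_one h0.le h1)
    exact ((summable_nat_add_iff 1).mpr this).neg
  have hnorm : ∀ j : ℕ, -(Q ^ (j + 1)) ≠ -1 := by
    intro j
    have : Q ^ (j + 1) < 1 := pow_lt_one₀ h0.le h1 (by omega)
    intro h; linarith
  have hmul : Multipliable (fun j : ℕ => 1 - Q ^ (j + 1)) := by
    simpa [sub_eq_add_neg] using Real.multipliable_one_add_of_summable hsum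
  have hT : Filter.Tendsto (qp Q) Filter.atTop (nhds (∏' j : ℕ, (1 - Q ^ (j + 1)))) :=
    hmul.hasProd.tendsto_prod_nat
  have hne : (∏' j : ℕ, (1 - Q ^ (j + 1))) ≠ 0 := by
    have := tprod_one_add_ne_zero_of_summable (f := fun j : ℕ => -(Q ^ (j + 1)))
      (fun j => by
        have : Q ^ (j + 1) < 1 := pow_lt_one₀ h0.le h1 (by omega)
        intro h; linarith) (by simpa using hsum.norm)
    simpa [sub_eq_add_neg] using this
  set L := ∏' j : ℕ, (1 - Q ^ (j + 1)) with hL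
  have hk := (qp_pos h0 h1 k).ne'
  rw [← Filter.tendsto_add_atTop_iff_nat k]
  have hcl : ∀ r : ℕ, hh k Q (r + k) (r + k) =
      Q ^ (k * k) * qp Q (r + k) * qp Q (r + k) / (qp Q k * qp Q k * qp Q r) := by
    intro r
    have := hh_closed k h0 h1 r k
    rwa [add_comm k r] at this
  simp_rw [hcl]
  have hTk := (Filter.tendsto_add_atTop_iff_nat k).mpr hT
  have := ((hTk.const_mul (Q ^ (k * k))).mul hTk).div (hT.const_mul (qp Q k * qp Q k))
    (mul_ne_zero (mul_ne_zero hk hk) hne)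
  convert this using 2
  · rfl
  change _ = Q ^ (k * k) * L * L / (qp Q k * qp Q k * L)
  change ((p : ℝ) ^ (k ^ 2))⁻¹ * L / (qp Q k) ^ 2 = _
  rw [← inv_pow, ← hQ, ← pow_two k]
  field_simp

end RankUniv

namespace RankUniv

open Finset

/-- Expectation over `m` random rows. -/
noncomputable def Ex {p : ℕ} [Fact p.Prime] {n : ℕ} (q : ℕ → Fin n → ZMod p → ℝ) (m : ℕ)
    (f : (Fin m → Fin n → ZMod p) → ℝ) : ℝ :=
  ∑ N : Fin m → Fin n → ZMod p, (∏ j : Fin m, mu (q j) (N j)) * f N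

section basics
variable {p : ℕ} [Fact p.Prime] {n : ℕ} {q : ℕ → Fin n → ZMod p → ℝ} {α : ℝ}

lemma wt_nonneg (hq : ∀ j l, Bal α (q j l)) {m : ℕ} (N : Fin m → Fin n → ZMod p) :
    0 ≤ ∏ j : Fin m, mu (q j) (N j) :=
  Finset.prod_nonneg fun j _ => mu_nonneg (hq j) _

lemma Ex_mono (hq : ∀ j l, Bal α (q j l)) {m : ℕ} {f g : (Fin m → Fin n → ZMod p) → ℝ}
    (h : ∀ N, f N ≤ g N) : Ex q m f ≤ Ex q m g :=
  Finset.sum_le_sum fun N _ => mul_le_mul_of_nonneg_left (h N) (wt_nonneg hq N)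

lemma Ex_const (hq : ∀ j l, Bal α (q j l)) {m : ℕ} (c : ℝ) : Ex q m (fun _ => c) = c := by
  unfold Ex
  rw [← Finset.sum_mul, sum_prod_fun (fun (j : Fin m) x => mu (q j) x),
    Finset.prod_eq_one fun (j : Fin m) _ => mu_sum (hq j), one_mul]

lemma Ex_sub {m : ℕ} (f g : (Fin m → Fin n → ZMod p) → ℝ) :
    Ex q m f - Ex q m g = Ex q m (fun N => f N - g N) := by
  unfold Ex
  rw [← Finset.sum_sub_distrib]
  exact Finset.sum_congr rfl fun N _ => by ring

lemma Ex_add {m : ℕ} (f g : (Fin m → Fin n → ZMod p) → ℝ) :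
    Ex q m (fun N => f N + g N) = Ex q m f + Ex q m g := by
  unfold Ex
  rw [← Finset.sum_add_distrib]
  exact Finset.sum_congr rfl fun N _ => by ring

lemma Ex_sum {m : ℕ} {κ : Type*} (s : Finset κ) (f : κ → (Fin m → Fin n → ZMod p) → ℝ) :
    Ex q m (fun N => ∑ i ∈ s, f i N) = ∑ i ∈ s, Ex q m (f i) := by
  unfold Ex
  simp_rw [Finset.mul_sum]
  rw [Finset.sum_comm]

lemma Ex_abs (hq : ∀ j l, Bal α (q j l)) {m : ℕ} (f : (Fin m → Fin n → ZMod p) → ℝ) :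
    |Ex q m f| ≤ Ex q m (fun N => |f N|) := by
  unfold Ex
  refine (Finset.abs_sum_le_sum_abs _ _).trans (le_of_eq ?_)
  exact Finset.sum_congr rfl fun N _ => by rw [abs_mul, abs_of_nonneg (wt_nonneg hq N)]

lemma Ex_succ {m : ℕ} (f : (Fin (m + 1) → Fin n → ZMod p) → ℝ) :
    Ex q (m + 1) f = Ex q m (fun N => ∑ x, mu (q m) x *
      f (Fin.snoc (α := fun _ => Fin n → ZMod p) N x)) := by
  unfold Ex
  rw [← (Fin.snocEquiv (fun _ : Fin (m + 1) => Fin n → ZMod p)).sum_comp, Fintype.sum_prod_type,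
    Finset.sum_comm]
  refine Finset.sum_congr rfl fun N _ => ?_
  rw [Finset.mul_sum]
  refine Finset.sum_congr rfl fun x _ => ?_
  rw [Fin.prod_univ_castSucc]
  simp [Fin.snocEquiv, mul_assoc]

/-- Right kernel of a family of rows. -/
noncomputable def Kr {m : ℕ} (N : Fin m → Fin n → ZMod p) : Submodule (ZMod p) (Fin n → ZMod p) :=
  LinearMap.ker (Matrix.mulVecLin (Matrix.of N))

lemma mem_Kr {m : ℕ} (N : Fin m → Fin n → ZMod p) (v : Fin n → ZMod p) :
    v ∈ Kr N ↔ ∀ j, v ⬝ᵥ N j = 0 := by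
  unfold Kr
  rw [LinearMap.mem_ker, Matrix.mulVecLin_apply, funext_iff]
  refine forall_congr' fun j => ?_
  rw [dotProduct_comm]
  rfl

/-- corank -/
noncomputable def kd {m : ℕ} (N : Fin m → Fin n → ZMod p) : ℕ := Module.finrank (ZMod p) (Kr N)

lemma rank_add_kd {m : ℕ} (N : Fin m → Fin n → ZMod p) : (Matrix.of N).rank + kd N = n := by
  have := LinearMap.finrank_range_add_finrank_ker (Matrix.mulVecLin (Matrix.of N))
  exact this.trans (by simp)

lemma kd_snoc_pos {m : ℕ} (N : Fin m → Fin n → ZMod p) (x : Fin n → ZMod p)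
    (h : ∀ v ∈ Kr N, v ⬝ᵥ x = 0) :
    kd (Fin.snoc (α := fun _ => Fin n → ZMod p) N x) = kd N := by
  have : Kr (Fin.snoc (α := fun _ => Fin n → ZMod p) N x) = Kr N := by
    ext v
    rw [mem_Kr, mem_Kr, Fin.forall_fin_succ']
    simp only [Fin.snoc_castSucc, Fin.snoc_last]
    constructor
    · exact fun h => h.1
    · intro h1
      exact ⟨h1, h v ((mem_Kr N v).mpr h1)⟩
  rw [kd, this, kd]

lemma kd_snoc_neg {m : ℕ} (N : Fin m → Fin n → ZMod p) (x : Fin n → ZMod p)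
    (h : ¬ ∀ v ∈ Kr N, v ⬝ᵥ x = 0) :
    kd (Fin.snoc (α := fun _ => Fin n → ZMod p) N x) = kd N - 1 := by
  let f : Module.Dual (ZMod p) (Kr N) :=
    { toFun := fun v => (v : Fin n → ZMod p) ⬝ᵥ x
      map_add' := by intro a b; simp [add_dotProduct]
      map_smul' := by intro a b; simp [smul_dotProduct] }
  have hf : f ≠ 0 := by
    intro hf
    apply h
    intro v hv
    exact DFunLike.congr_fun hf (⟨v, hv⟩ : Kr N)
  have h1 := Module.Dual.finrank_ker_add_one_of_ne_zero hf
  have h2 : Kr (Fin.snoc (α := fun _ => Fin n → ZMod p) N x) =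
      (LinearMap.ker f).map (Kr N).subtype := by
    ext v
    rw [mem_Kr, Fin.forall_fin_succ']
    simp only [Fin.snoc_castSucc, Fin.snoc_last]
    rw [← mem_Kr]
    simp [f, and_comm]
  have h3 : kd (Fin.snoc (α := fun _ => Fin n → ZMod p) N x) =
      Module.finrank (ZMod p) (LinearMap.ker f) := by
    rw [kd, h2]
    exact Submodule.finrank_map_subtype_eq _ _
  have h4 : kd N = Module.finrank (ZMod p) (Kr N) := rfl
  omega

end basics

/-- existence of a light kernel vector -/
def Bad {p : ℕ} [Fact p.Prime] {n : ℕ} (δ : ℝ) {m : ℕ} (N : Fin m → Fin n → ZMod p) : Prop :=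
  ∃ v ∈ Kr N, v ≠ 0 ∧ (hammingNorm v : ℝ) < δ * n

/-- error term -/
noncomputable def eta (p n : ℕ) (z : ℝ) : ℝ :=
  ((1 + ((p : ℝ) - 1) * z) ^ n - 1) + Real.exp (-((n : ℝ) / 16))

open Classical in
lemma bad_bound {p : ℕ} [Fact p.Prime] {c : ℝ} (hc0 : 0 < c)
    (hc : ∀ (α : ℝ) (q : ZMod p → ℝ), Bal α q → ∀ t : ZMod p, t ≠ 0 →
      ‖∑ a, (q a : ℂ) * ZMod.stdAddChar (t * a)‖ ≤ Real.exp (-(c * α)))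
    {δ : ℝ} (hδ : ∀ a n : ℕ, a ≤ n →
    ∑ v : Fin a → ZMod p, (if (hammingNorm v : ℝ) < δ * n then (1 : ℝ) else 0)
      ≤ Real.exp ((n : ℝ) / 16))
    {n : ℕ} {α z : ℝ} (hα : 0 < α)
    (hz1 : Real.exp (-(n * (c * α) / 8)) ≤ z)
    {q : ℕ → Fin n → ZMod p → ℝ} (hq : ∀ j l, Bal α (q j l))
    {m : ℕ} (hm : n ≤ 2 * m) :
    Ex q m (fun N => if Bad δ N then 1 else 0) ≤ eta p n z := by
  refine le_trans ?_ (light_sum p hδ (le_refl n) hm (mul_pos hc0 hα).le hz1)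
  calc Ex q m (fun N => if Bad δ N then 1 else 0)
      ≤ Ex q m (fun N => ∑ v : Fin n → ZMod p, if v ≠ 0 ∧ (hammingNorm v : ℝ) < δ * n then
          ∏ j, (if v ⬝ᵥ N j = 0 then (1 : ℝ) else 0) else 0) := by
        refine Ex_mono hq fun N => ?_
        have hnn : ∀ v : Fin n → ZMod p, 0 ≤ (if v ≠ 0 ∧ (hammingNorm v : ℝ) < δ * n then
          ∏ j, (if v ⬝ᵥ N j = 0 then (1 : ℝ) else 0) else 0) := by
          intro v
          split_ifs
          · exact Finset.prod_nonneg fun j _ => by split_ifs <;> norm_num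
          · exact le_rfl
        split_ifs with hB
        · obtain ⟨v, hv, hv0, hvw⟩ := hB
          refine le_trans ?_ (Finset.single_le_sum (fun v _ => hnn v) (Finset.mem_univ v))
          rw [if_pos ⟨hv0, hvw⟩]
          rw [Finset.prod_eq_one]
          intro j _
          rw [if_pos ((mem_Kr N v).mp hv j)]
        · exact Finset.sum_nonneg fun v _ => hnn v
    _ ≤ _ := by
        rw [Ex_sum]
        refine Finset.sum_le_sum fun v _ => ?_
        split_ifs with h
        · unfold Ex
          simp_rw [← Finset.prod_mul_distrib]
          rw [sum_prod_fun (fun (j : Fin m) x => mu (q j) x * (if v ⬝ᵥ x = 0 then (1 : ℝ) else 0))]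
          calc _ ≤ ∏ j : Fin m, ((p : ℝ)⁻¹ + (1 - (p : ℝ)⁻¹) *
                Real.exp (-(c * α * hammingNorm v))) := by
                refine Finset.prod_le_prod (fun j _ => Finset.sum_nonneg fun x _ => ?_)
                  fun j _ => ?_
                · exact mul_nonneg (mu_nonneg (hq j) x) (by split_ifs <;> norm_num)
                · have := prob_orth hc0 hc hα (hq j) v h.1
                  simpa only [mul_ite, mul_one, mul_zero] using this
            _ = _ := by simp
        · exact (Ex_const hq 0).le

open Classical in
lemma def_bound {p : ℕ} [Fact p.Prime] {c : ℝ} (hc0 : 0 < c)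
    (hc : ∀ (α : ℝ) (q : ZMod p → ℝ), Bal α q → ∀ t : ZMod p, t ≠ 0 →
      ‖∑ a, (q a : ℂ) * ZMod.stdAddChar (t * a)‖ ≤ Real.exp (-(c * α)))
    {δ : ℝ} (hδ : ∀ a n : ℕ, a ≤ n →
    ∑ v : Fin a → ZMod p, (if (hammingNorm v : ℝ) < δ * n then (1 : ℝ) else 0)
      ≤ Real.exp ((n : ℝ) / 16))
    {n : ℕ} {α z : ℝ} (hα : 0 < α)
    (hz1 : Real.exp (-(n * (c * α) / 8)) ≤ z) (hz2 : Real.exp (-(c * α * (δ * n))) ≤ z)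
    {q : ℕ → Fin n → ZMod p → ℝ} (hq : ∀ j l, Bal α (q j l))
    {s : ℕ} (hs : s ≤ n) :
    Ex q (n - s) (fun N => if kd N ≠ s then 1 else 0)
      ≤ eta p n z + ((p : ℝ) ^ s)⁻¹ * (1 + (p - 1) * z) ^ n := by
  refine le_trans ?_ (add_le_add (light_sum p hδ (Nat.sub_le n s) (show n ≤ 2 * n by omega)
    (mul_pos hc0 hα).le hz1) (heavy_sum p hs (mul_pos hc0 hα).le hz2))
  rw [← Finset.sum_add_distrib]
  calc Ex q (n - s) (fun N => if kd N ≠ s then 1 else 0)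
      ≤ Ex q (n - s) (fun N => ∑ u : Fin (n - s) → ZMod p, if u ≠ 0 then
          ∏ l, (if u ⬝ᵥ (fun j => N j l) = 0 then (1 : ℝ) else 0) else 0) := by
        refine Ex_mono hq fun N => ?_
        have hnn : ∀ u : Fin (n - s) → ZMod p, 0 ≤ (if u ≠ 0 then
          ∏ l, (if u ⬝ᵥ (fun j => N j l) = 0 then (1 : ℝ) else 0) else 0) := by
          intro v
          split_ifs
          · exact Finset.prod_nonneg fun j _ => by split_ifs <;> norm_num
          · exact le_rfl
        split_ifs with hB
        · have hex : ∃ u : Fin (n - s) → ZMod p, u ≠ 0 ∧ ∀ l, u ⬝ᵥ (fun j => N j l) = 0 := by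
            by_contra hcon
            push Not at hcon
            apply hB
            have hli : LinearIndependent (ZMod p) (Matrix.of N).row := by
              rw [Fintype.linearIndependent_iff]
              intro g hg
              by_contra hne
              have hg0 : g ≠ 0 := by
                rintro rfl
                apply hne; intro i; rfl
              obtain ⟨l, hl⟩ := hcon g hg0
              apply hl
              have := congrFun hg l
              simpa [dotProduct, Finset.sum_apply] using this
            have h1 := hli.rank_matrix
            rw [Fintype.card_fin] at h1
            have h2 := rank_add_kd N
            omega
          obtain ⟨u, hu0, hu⟩ := hex
          refine le_trans ?_ (Finset.single_le_sum (fun v _ => hnn v) (Finset.mem_univ u))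
          rw [if_pos hu0, Finset.prod_eq_one]
          intro l _
          rw [if_pos (hu l)]
        · exact Finset.sum_nonneg fun v _ => hnn v
    _ ≤ _ := by
        rw [Ex_sum]
        refine Finset.sum_le_sum fun u _ => ?_
        have hp1 : (p : ℝ)⁻¹ ≤ 1 :=
          inv_le_one_of_one_le₀ (by exact_mod_cast (Fact.out : p.Prime).one_lt.le)
        have hbase : 0 ≤ ((p : ℝ)⁻¹ + (1 - (p : ℝ)⁻¹) *
                Real.exp (-(c * α * hammingNorm u))) := by
          have : 0 ≤ (1 - (p : ℝ)⁻¹) * Real.exp (-(c * α * hammingNorm u)) :=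
            mul_nonneg (by linarith) (Real.exp_pos _).le
          positivity
        by_cases hu : u ≠ 0
        · have key : Ex q (n - s) (fun N => if u ≠ 0 then
              ∏ l, (if u ⬝ᵥ (fun j => N j l) = 0 then (1 : ℝ) else 0) else 0) ≤
              ((p : ℝ)⁻¹ + (1 - (p : ℝ)⁻¹) * Real.exp (-(c * α * hammingNorm u))) ^ n := by
            simp only [if_pos hu]
            unfold Ex
            have e : ∀ N : Fin (n - s) → Fin n → ZMod p, (∏ j : Fin (n - s), mu (q j) (N j)) *
                (∏ l, (if u ⬝ᵥ (fun j => N j l) = 0 then (1 : ℝ) else 0)) =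
                ∏ l, (mu (fun j : Fin (n - s) => q j l) (fun j => N j l) *
                  (if u ⬝ᵥ (fun j => N j l) = 0 then (1 : ℝ) else 0)) := by
              intro N
              rw [Finset.prod_mul_distrib]
              congr 1
              unfold mu
              rw [Finset.prod_comm]
            simp_rw [e]
            rw [← (Equiv.piComm (fun (_ : Fin n) (_ : Fin (n - s)) => ZMod p)).sum_comp]
            simp only [Equiv.piComm_apply, Function.swap]
            rw [sum_prod_fun (fun (l : Fin n) (y : Fin (n - s) → ZMod p) =>
              mu (fun j : Fin (n - s) => q j l) y * (if u ⬝ᵥ y = 0 then (1 : ℝ) else 0))]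
            calc _ ≤ ∏ l : Fin n, ((p : ℝ)⁻¹ + (1 - (p : ℝ)⁻¹) *
                  Real.exp (-(c * α * hammingNorm u))) := by
                  refine Finset.prod_le_prod (fun l _ => Finset.sum_nonneg fun x _ => ?_)
                    fun l _ => ?_
                  · exact mul_nonneg (mu_nonneg (fun j : Fin (n - s) => hq j l) x)
                      (by split_ifs <;> norm_num)
                  · have := prob_orth hc0 hc hα (fun j : Fin (n - s) => hq j l) u hu
                    simpa only [mul_ite, mul_one, mul_zero] using this
              _ = _ := by simp
          refine key.trans ?_
          by_cases hw : (hammingNorm u : ℝ) < δ * n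
          · rw [if_pos ⟨hu, hw⟩, if_neg (not_not.mpr hw), add_zero]
          · rw [if_neg (by tauto), if_pos hw, zero_add]
        · simp only [if_neg hu]
          rw [Ex_const hq 0]
          have hpn := pow_nonneg hbase n
          rw [if_neg (by tauto), zero_add]
          split_ifs
          · exact le_rfl
          · exact hpn

open Classical in
lemma step_bound {p : ℕ} [Fact p.Prime] {c : ℝ} (hc0 : 0 < c)
    (hc : ∀ (α : ℝ) (q : ZMod p → ℝ), Bal α q → ∀ t : ZMod p, t ≠ 0 →
      ‖∑ a, (q a : ℂ) * ZMod.stdAddChar (t * a)‖ ≤ Real.exp (-(c * α)))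
    {δ : ℝ} (hδ : ∀ a n : ℕ, a ≤ n →
    ∑ v : Fin a → ZMod p, (if (hammingNorm v : ℝ) < δ * n then (1 : ℝ) else 0)
      ≤ Real.exp ((n : ℝ) / 16))
    {n : ℕ} {α z : ℝ} (hα : 0 < α)
    (hz1 : Real.exp (-(n * (c * α) / 8)) ≤ z) (hz2 : Real.exp (-(c * α * (δ * n))) ≤ z)
    {q : ℕ → Fin n → ZMod p → ℝ} (hq : ∀ j l, Bal α (q j l))
    (k t : ℕ) {m : ℕ} (hm : n ≤ 2 * m) :
    |Ex q (m + 1) (fun N => hh k ((p : ℝ)⁻¹) t (kd N)) -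
      Ex q m (fun N => hh k ((p : ℝ)⁻¹) (t + 1) (kd N))| ≤ eta p n z + z := by
  have hp2 : (2 : ℝ) ≤ p := by exact_mod_cast (Fact.out : p.Prime).two_le
  set Q := (p : ℝ)⁻¹ with hQ
  have hQ0 : 0 < Q := inv_pos.mpr (by linarith)
  have hQ1 : Q < 1 := inv_lt_one_of_one_lt₀ (by linarith)
  have hz0 : 0 < z := (Real.exp_pos _).trans_le hz1
  rw [Ex_succ, Ex_sub]
  refine (Ex_abs hq _).trans ?_
  calc _ ≤ Ex q m (fun N => (if Bad δ N then 1 else 0) + z) := by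
        refine Ex_mono hq fun N => ?_
        set P := ∑ x, if (∀ v ∈ Kr N, v ⬝ᵥ x = 0) then mu (q m) x else 0 with hP
        have hsum : ∑ x, mu (q m) x * hh k Q t (kd (Fin.snoc (α := fun _ => Fin n → ZMod p) N x))
            = P * hh k Q t (kd N) + (1 - P) * hh k Q t (kd N - 1) := by
          have hPc : 1 - P = ∑ x, if (∀ v ∈ Kr N, v ⬝ᵥ x = 0) then 0 else mu (q m) x := by
            rw [← mu_sum (hq m), hP, ← Finset.sum_sub_distrib]
            refine Finset.sum_congr rfl fun x _ => ?_
            split_ifs <;> simp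
          rw [hPc, hP, Finset.sum_mul, Finset.sum_mul, ← Finset.sum_add_distrib]
          refine Finset.sum_congr rfl fun x _ => ?_
          split_ifs with h
          · rw [kd_snoc_pos N x h]; ring
          · rw [kd_snoc_neg N x h]; ring
        rw [hsum]
        have hstep : hh k Q (t + 1) (kd N) =
          Q ^ (kd N) * hh k Q t (kd N) + (1 - Q ^ (kd N)) * hh k Q t (kd N - 1) := rfl
        rw [hstep]
        obtain ⟨a0, a1⟩ := hh_mem k hQ0 hQ1 t (kd N)
        obtain ⟨b0, b1⟩ := hh_mem k hQ0 hQ1 t (kd N - 1)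
        have e : P * hh k Q t (kd N) + (1 - P) * hh k Q t (kd N - 1) -
          (Q ^ (kd N) * hh k Q t (kd N) + (1 - Q ^ (kd N)) * hh k Q t (kd N - 1)) =
          (P - Q ^ (kd N)) * (hh k Q t (kd N) - hh k Q t (kd N - 1)) := by ring
        rw [e, abs_mul]
        have hdiff : |hh k Q t (kd N) - hh k Q t (kd N - 1)| ≤ 1 := by
          rw [abs_le]; constructor <;> linarith
        have hred : |P - Q ^ (kd N)| * |hh k Q t (kd N) - hh k Q t (kd N - 1)| ≤
            |P - Q ^ (kd N)| := by
          have := mul_le_mul_of_nonneg_left hdiff (abs_nonneg (P - Q ^ (kd N)))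
          linarith
        refine hred.trans ?_
        have hQd0 : 0 < Q ^ (kd N) := pow_pos hQ0 _
        have hQd1 : Q ^ (kd N) ≤ 1 := pow_le_one₀ hQ0.le hQ1.le
        split_ifs with hB
        · have hP0 : 0 ≤ P := Finset.sum_nonneg fun x _ => by
            split_ifs
            · exact mu_nonneg (hq m) x
            · exact le_rfl
          have hP1 : P ≤ 1 := by
            rw [← mu_sum (hq m)]
            refine Finset.sum_le_sum fun x _ => ?_
            split_ifs
            · exact le_rfl
            · exact mu_nonneg (hq m) x
          have : |P - Q ^ (kd N)| ≤ 1 := by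
            rw [abs_le]; constructor <;> linarith
          linarith
        · have h := fourier hc0 hc hα (hq m) (Kr N) (δ * n) (by
            intro v hv hv0
            by_contra hlt
            push Not at hlt
            exact hB ⟨v, hv, hv0, hlt⟩)
          have e2 : ((p : ℝ) ^ Module.finrank (ZMod p) (Kr N))⁻¹ = Q ^ (kd N) := by
            rw [hQ, inv_pow]; rfl
          rw [e2] at h
          refine h.trans ?_
          rw [zero_add]
          exact (mul_le_of_le_one_left (Real.exp_pos _).le (by linarith)).trans hz2
    _ = Ex q m (fun N => if Bad δ N then 1 else 0) + z := by
        rw [Ex_add, Ex_const hq]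
    _ ≤ _ := by
        have := bad_bound hc0 hc hδ hα hz1 hq hm
        linarith

open Classical in
lemma total_bound {p : ℕ} [Fact p.Prime] {c : ℝ} (hc0 : 0 < c)
    (hc : ∀ (α : ℝ) (q : ZMod p → ℝ), Bal α q → ∀ t : ZMod p, t ≠ 0 →
      ‖∑ a, (q a : ℂ) * ZMod.stdAddChar (t * a)‖ ≤ Real.exp (-(c * α)))
    {δ : ℝ} (hδ : ∀ a n : ℕ, a ≤ n →
    ∑ v : Fin a → ZMod p, (if (hammingNorm v : ℝ) < δ * n then (1 : ℝ) else 0)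
      ≤ Real.exp ((n : ℝ) / 16))
    {n : ℕ} {α z : ℝ} (hα : 0 < α)
    (hz1 : Real.exp (-(n * (c * α) / 8)) ≤ z) (hz2 : Real.exp (-(c * α * (δ * n))) ≤ z)
    {q : ℕ → Fin n → ZMod p → ℝ} (hq : ∀ j l, Bal α (q j l))
    (k s : ℕ) (hs : 2 * s ≤ n) :
    |Ex q n (fun N => hh k ((p : ℝ)⁻¹) 0 (kd N)) - hh k ((p : ℝ)⁻¹) s s| ≤
      s * (eta p n z + z) + (eta p n z + ((p : ℝ) ^ s)⁻¹ * (1 + (p - 1) * z) ^ n) := by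
  have hp2 : (2 : ℝ) ≤ p := by exact_mod_cast (Fact.out : p.Prime).two_le
  have hQ0 : 0 < (p : ℝ)⁻¹ := inv_pos.mpr (by linarith)
  have hQ1 : (p : ℝ)⁻¹ < 1 := inv_lt_one_of_one_lt₀ (by linarith)
  let A : ℕ → ℕ → ℝ := fun m t => Ex q m (fun N => hh k ((p : ℝ)⁻¹) t (kd N))
  have hA : ∀ t, t ≤ s → |A n 0 - A (n - t) t| ≤ t * (eta p n z + z) := by
    intro t
    induction t with
    | zero => intro _; simp
    | succ t ih =>
      intro ht
      have h1 := ih (by omega)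
      have h2 : |A (n - (t + 1) + 1) t - A (n - (t + 1)) (t + 1)| ≤ eta p n z + z :=
        step_bound hc0 hc hδ hα hz1 hz2 hq k t (by omega)
      rw [show n - (t + 1) + 1 = n - t by omega] at h2
      have h3 := abs_sub_le (A n 0) (A (n - t) t) (A (n - (t + 1)) (t + 1))
      push_cast
      linarith
  have h1 := hA s le_rfl
  have h2 : |A (n - s) s - hh k ((p : ℝ)⁻¹) s s| ≤
      eta p n z + ((p : ℝ) ^ s)⁻¹ * (1 + (p - 1) * z) ^ n := by
    refine le_trans ?_ (def_bound hc0 hc hδ hα hz1 hz2 hq (show s ≤ n by omega))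
    have e : A (n - s) s - hh k ((p : ℝ)⁻¹) s s =
      Ex q (n - s) (fun N => hh k ((p : ℝ)⁻¹) s (kd N) - hh k ((p : ℝ)⁻¹) s s) := by
      rw [← Ex_sub, Ex_const hq]
    rw [e]
    refine (Ex_abs hq _).trans (Ex_mono hq fun N => ?_)
    split_ifs with h
    · obtain ⟨a0, a1⟩ := hh_mem k hQ0 hQ1 s (kd N)
      obtain ⟨b0, b1⟩ := hh_mem k hQ0 hQ1 s s
      rw [abs_le]; constructor <;> linarith
    · push Not at h
      rw [h]; simp
  have h3 := abs_sub_le (A n 0) (A (n - s) s) (hh k ((p : ℝ)⁻¹) s s)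
  change |A n 0 - _| ≤ _
  linarith


end RankUniv

namespace RankUniv

open Finset Filter Topology

lemma pow_lim (p : ℕ) [Fact p.Prime] :
    Tendsto (fun n : ℕ => (1 + ((p : ℝ) - 1) * ((n : ℝ) ^ 2)⁻¹) ^ n) atTop (𝓝 1) := by
  have hp2 : (2 : ℝ) ≤ p := by exact_mod_cast (Fact.out : p.Prime).two_le
  have hup : Tendsto (fun n : ℕ => Real.exp (((p : ℝ) - 1) * (n : ℝ)⁻¹)) atTop (𝓝 1) := by
    have h1 : Tendsto (fun n : ℕ => ((p : ℝ) - 1) * (n : ℝ)⁻¹) atTop (𝓝 0) := by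
      simpa using (tendsto_inv_atTop_nhds_zero_nat (𝕜 := ℝ)).const_mul ((p : ℝ) - 1)
    have := (Real.continuous_exp.tendsto 0).comp h1
    rw [Real.exp_zero] at this
    exact this
  refine tendsto_of_tendsto_of_tendsto_of_le_of_le tendsto_const_nhds hup ?_ ?_
  · intro n
    refine one_le_pow₀ ?_
    have : 0 ≤ ((p : ℝ) - 1) * ((n : ℝ) ^ 2)⁻¹ := mul_nonneg (by linarith) (by positivity)
    linarith
  · intro n
    change (1 + ((p : ℝ) - 1) * ((n : ℝ) ^ 2)⁻¹) ^ n ≤ Real.exp (((p : ℝ) - 1) * (n : ℝ)⁻¹)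
    have h0 : 0 ≤ ((p : ℝ) - 1) * ((n : ℝ) ^ 2)⁻¹ := mul_nonneg (by linarith) (by positivity)
    have h1 := Real.add_one_le_exp (((p : ℝ) - 1) * ((n : ℝ) ^ 2)⁻¹)
    refine (pow_le_pow_left₀ (by linarith) (show 1 + ((p : ℝ) - 1) * ((n : ℝ) ^ 2)⁻¹ ≤ _ by
      linarith) n).trans ?_
    rw [← Real.exp_nat_mul]
    apply le_of_eq
    congr 1
    rcases Nat.eq_zero_or_pos n with rfl | hn
    · simp
    · field_simp

lemma z_lim : Tendsto (fun n : ℕ => ((n : ℝ) ^ 2)⁻¹) atTop (𝓝 0) := by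
  have := (tendsto_inv_atTop_nhds_zero_nat (𝕜 := ℝ)).pow 2
  simpa using this

lemma eta_lim (p : ℕ) [Fact p.Prime] :
    Tendsto (fun n : ℕ => eta p n (((n : ℝ) ^ 2)⁻¹)) atTop (𝓝 0) := by
  have h1 : Tendsto (fun n : ℕ => Real.exp (-((n : ℝ) / 16))) atTop (𝓝 0) := by
    apply Real.tendsto_exp_neg_atTop_nhds_zero.comp
    exact tendsto_natCast_atTop_atTop.atTop_div_const (by norm_num)
  have := ((pow_lim p).sub_const 1).add h1
  simpa [eta] using this

end RankUniv

open RankUniv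

/-- Theorem 1.2 of the paper.
Let `p` be a prime and `k ≥ 0`. Let `(α_n)` be positive reals such that for every `Δ > 0`
one has `α_n ≥ Δ (log n)/n` for all sufficiently large `n`. For every `n ≥ 2` let
`q n k' l'` be an `α_n`-balanced probability mass function on `F_p`, and let `P_n` be the
induced product probability on `M_n(F_p)`. Then the probability that an `n × n` random
matrix has rank `n − k` tends to `p^{−k²}·(∏_{j≥1}(1−p^{−j}))/(∏_{j=1}^k (1−p^{−j}))²`. -/
theorem stmt_1 (p : ℕ) [Fact p.Prime] (k : ℕ) (α : ℕ → ℝ) (hα : ∀ n, 0 < α n)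
    (hαlog : ∀ Δ : ℝ, 0 < Δ → ∀ᶠ n : ℕ in Filter.atTop, Δ * Real.log n / n ≤ α n)
    (q : (n : ℕ) → Fin n → Fin n → ZMod p → ℝ)
    (hq0 : ∀ n k' l' a, 0 ≤ q n k' l' a)
    (hq1 : ∀ n k' l', ∑ a : ZMod p, q n k' l' a = 1)
    (hbal : ∀ n, 2 ≤ n → ∀ k' l' (a : ZMod p), q n k' l' a ≤ 1 - α n) :
    Filter.Tendsto (fun n : ℕ =>
      ∑ M ∈ Finset.univ.filter (fun M : Matrix (Fin n) (Fin n) (ZMod p) => M.rank = n - k),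
        ∏ k' : Fin n, ∏ l' : Fin n, q n k' l' (M k' l'))
      Filter.atTop
      (nhds (((p : ℝ) ^ (k ^ 2))⁻¹ *
        (∏' j : ℕ, (1 - (p : ℝ)⁻¹ ^ (j + 1))) /
        (∏ j ∈ Finset.range k, (1 - (p : ℝ)⁻¹ ^ (j + 1))) ^ 2)) := by
  have hp2 : (2 : ℝ) ≤ p := by exact_mod_cast (Fact.out : p.Prime).two_le
  have hlim := hh_limit p k
  set L := ((p : ℝ) ^ (k ^ 2))⁻¹ * (∏' j : ℕ, (1 - (p : ℝ)⁻¹ ^ (j + 1))) /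
        (∏ j ∈ Finset.range k, (1 - (p : ℝ)⁻¹ ^ (j + 1))) ^ 2 with hL
  obtain ⟨c, hc0, hc⟩ := char_bound p
  obtain ⟨δ, hδ0, hδ⟩ := count_light p
  set κ := min δ (1 / 8) with hκ
  have hκ0 : 0 < κ := lt_min hδ0 (by norm_num)
  -- main estimate for a fixed number `s` of final rows
  have hmain : ∀ s : ℕ, ∀ᶠ n : ℕ in Filter.atTop,
      |(∑ M ∈ Finset.univ.filter (fun M : Matrix (Fin n) (Fin n) (ZMod p) => M.rank = n - k),
        ∏ k' : Fin n, ∏ l' : Fin n, q n k' l' (M k' l')) - hh k ((p : ℝ)⁻¹) s s| ≤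
      s * (eta p n (((n : ℝ) ^ 2)⁻¹) + ((n : ℝ) ^ 2)⁻¹) + (eta p n (((n : ℝ) ^ 2)⁻¹) +
        ((p : ℝ) ^ s)⁻¹ * (1 + (p - 1) * ((n : ℝ) ^ 2)⁻¹) ^ n) := by
    intro s
    filter_upwards [hαlog (2 / (c * κ)) (by positivity), Filter.eventually_ge_atTop (2 * s),
      Filter.eventually_ge_atTop k, Filter.eventually_ge_atTop 2] with n hn hns hnk hn2
    have hnpos : 0 < n := by omega
    have hnR : (0 : ℝ) < n := by exact_mod_cast hnpos
    have hbig : 2 * Real.log n ≤ c * α n * (κ * n) := by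
      rw [div_le_iff₀ hnR, div_mul_eq_mul_div, div_le_iff₀ (by positivity)] at hn
      linarith
    have hzexp : Real.exp (-(2 * Real.log n)) = ((n : ℝ) ^ 2)⁻¹ := by
      rw [Real.exp_neg, show 2 * Real.log n = ((2 : ℕ) : ℝ) * Real.log n by norm_num,
        Real.exp_nat_mul, Real.exp_log hnR]
    have hcα : 0 < c * α n * n := mul_pos (mul_pos hc0 (hα n)) hnR
    have hz1 : Real.exp (-(n * (c * α n) / 8)) ≤ ((n : ℝ) ^ 2)⁻¹ := by
      rw [← hzexp]
      apply Real.exp_le_exp.mpr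
      have : c * α n * n * κ ≤ c * α n * n * (1 / 8) :=
        mul_le_mul_of_nonneg_left (min_le_right _ _) hcα.le
      linarith
    have hz2 : Real.exp (-(c * α n * (δ * n))) ≤ ((n : ℝ) ^ 2)⁻¹ := by
      rw [← hzexp]
      apply Real.exp_le_exp.mpr
      have : c * α n * n * κ ≤ c * α n * n * δ :=
        mul_le_mul_of_nonneg_left (min_le_left _ _) hcα.le
      linarith
    let q' : ℕ → Fin n → ZMod p → ℝ := fun j => q n ⟨min j (n - 1), by omega⟩
    have hq' : ∀ j l, Bal (α n) (q' j l) := fun j l =>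
      ⟨fun a => hq0 n _ l a, hq1 n _ l, fun a => hbal n hn2 _ l a⟩
    have htot := total_bound hc0 hc hδ (hα n) hz1 hz2 hq' k s hns
    have hEx : (∑ M ∈ Finset.univ.filter
        (fun M : Matrix (Fin n) (Fin n) (ZMod p) => M.rank = n - k),
        ∏ k' : Fin n, ∏ l' : Fin n, q n k' l' (M k' l')) =
        Ex q' n (fun N => hh k ((p : ℝ)⁻¹) 0 (kd N)) := by
      unfold Ex
      rw [Finset.sum_filter]
      refine Finset.sum_congr rfl fun M _ => ?_
      have hr := rank_add_kd M
      change Matrix.rank M + kd M = n at hr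
      have hw : ∏ j : Fin n, mu (q' j) (M j) = ∏ k' : Fin n, ∏ l' : Fin n, q n k' l' (M k' l') := by
        refine Finset.prod_congr rfl fun j _ => ?_
        unfold mu
        have : (⟨min (j : ℕ) (n - 1), by omega⟩ : Fin n) = j := by
          ext; simp; omega
        simp only [q', this]
      rw [hw]
      simp only [hh]
      by_cases hk : kd M = k
      · rw [if_pos (show Matrix.rank M = n - k by omega), if_pos hk, mul_one]
      · rw [if_neg (show ¬ Matrix.rank M = n - k by omega), if_neg hk, mul_zero]
    rw [hEx]
    exact htot
  rw [Metric.tendsto_atTop'] at hlim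
  rw [Metric.tendsto_nhds]
  intro ε hε
  obtain ⟨s1, hs1⟩ := hlim (ε / 3) (by positivity)
  obtain ⟨s2, hs2⟩ := exists_pow_lt_of_lt_one (show 0 < ε / 3 by positivity)
    (show (p : ℝ)⁻¹ < 1 from inv_lt_one_of_one_lt₀ (by linarith))
  set s := max (s1 + 1) s2 with hs
  have hs1' := hs1 s (by omega)
  have hs2' : ((p : ℝ) ^ s)⁻¹ < ε / 3 := by
    rw [← inv_pow]
    exact (pow_le_pow_of_le_one (by positivity) (inv_le_one_of_one_le₀ (by linarith))
      (le_max_right _ _)).trans_lt hs2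
  have hB : Filter.Tendsto (fun n : ℕ =>
      s * (eta p n (((n : ℝ) ^ 2)⁻¹) + ((n : ℝ) ^ 2)⁻¹) + (eta p n (((n : ℝ) ^ 2)⁻¹) +
        ((p : ℝ) ^ s)⁻¹ * (1 + (p - 1) * ((n : ℝ) ^ 2)⁻¹) ^ n)) Filter.atTop
      (nhds (((p : ℝ) ^ s)⁻¹)) := by
    have := (((eta_lim p).add z_lim).const_mul (s : ℝ)).add
      ((eta_lim p).add ((pow_lim p).const_mul (((p : ℝ) ^ s)⁻¹)))
    simpa using this
  filter_upwards [hmain s, hB.eventually_lt_const hs2'] with n h1 h2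
  rw [Real.dist_eq] at hs1' ⊢
  have h3 := abs_sub_le (∑ M ∈ Finset.univ.filter
        (fun M : Matrix (Fin n) (Fin n) (ZMod p) => M.rank = n - k),
        ∏ k' : Fin n, ∏ l' : Fin n, q n k' l' (M k' l')) (hh k ((p : ℝ)⁻¹) s s) L
  linarith
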